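/- Fix an integer p ≥ 2 and suppose the complex numbers z₁, …, z_{2p−1} satisfy the gluing system. If Re(z₂) = 1, then Im(z₂) = 0. -/

import Mathlib

/-- The gluing system for the `p`-th twist knot: `z 1, …, z (2p-1)` are complex numbers,
none of which is a nonnegative real number, satisfying the critical-point equations of
the potential function `f`. -/
def GluingSystem (p : ℕ) (z : ℕ → ℂ) : Prop :=
  (∀ i : ℕ, 1 ≤ i → i ≤ 2 * p - 1 → ¬ ∃ r : ℝ, 0 ≤ r ∧ z i = (r : ℂ)) ∧
  (1 - z 1 / z 2 = (1 - z 1) * (1 - 1 / z 1)) ∧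
  (∀ i : ℕ, 2 ≤ i → i ≤ 2 * p - 2 →
    (1 - z i / z (i + 1)) * (1 - 1 / z i) = (1 - z i) * (1 - z (i - 1) / z i)) ∧
  (1 - 1 / z (2 * p - 1) = (1 - z (2 * p - 1)) * (1 - z (2 * p - 2) / z (2 * p - 1)))

open Polynomial

/-- Fibonacci-type polynomials. -/
noncomputable def fibY : ℕ → ℤ[X]
  | 0 => 1
  | 1 => 1
  | (n + 2) => X * fibY (n + 1) + fibY n

/-- Their values at a complex number. -/
noncomputable def evY (s : ℂ) (n : ℕ) : ℂ := aeval s (fibY n)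

lemma evY_zero (s : ℂ) : evY s 0 = 1 := by simp [evY, fibY]
lemma evY_one (s : ℂ) : evY s 1 = 1 := by simp [evY, fibY]
lemma evY_add_two (s : ℂ) (n : ℕ) : evY s (n + 2) = s * evY s (n + 1) + evY s n := by
  simp [evY, fibY]

lemma fibY_props (n : ℕ) : (fibY (n + 1)).Monic ∧ (fibY (n + 1)).natDegree = n ∧
    (fibY (n + 2)).Monic ∧ (fibY (n + 2)).natDegree = n + 1 ∧ (fibY (n + 2)).coeff n = 1 := by
  induction n with
  | zero =>
    have h1 : fibY 1 = 1 := rfl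
    have h2 : fibY 2 = X + C 1 := by simp [fibY]
    refine ⟨?_, ?_, ?_, ?_, ?_⟩
    · rw [h1]; exact monic_one
    · rw [h1]; exact natDegree_one
    · rw [h2]; exact monic_X_add_C 1
    · rw [h2]; exact natDegree_X_add_C 1
    · rw [h2]; simp
  | succ n ih =>
    obtain ⟨m1, d1, m2, d2, c2⟩ := ih
    have h3 : fibY (n + 1 + 2) = X * fibY (n + 2) + fibY (n + 1) := rfl
    have mX : (X * fibY (n + 2)).Monic := monic_X.mul m2
    have dX : (X * fibY (n + 2)).natDegree = n + 2 := by
      rw [monic_X.natDegree_mul m2, d2, natDegree_X]; ring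
    have hlt : (fibY (n + 1)).natDegree < (X * fibY (n + 2)).natDegree := by omega
    refine ⟨m2, d2, ?_, ?_, ?_⟩
    · rw [h3]; exact mX.add_of_left (degree_lt_degree hlt)
    · rw [h3, natDegree_add_eq_left_of_natDegree_lt hlt, dX]
    · rw [h3, coeff_add, coeff_X_mul, c2, coeff_eq_zero_of_natDegree_lt (by omega)]; ring

lemma evY_re_pos (s : ℂ) (hs : 0 ≤ s.re) (n : ℕ) :
    1 ≤ (evY s (n + 1) * (starRingEnd ℂ) (evY s n)).re := by
  induction n with
  | zero => simp [evY_zero, evY_one]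
  | succ n ih =>
    rw [evY_add_two]
    simp only [Complex.mul_re, Complex.add_re, Complex.add_im, Complex.mul_im,
      Complex.conj_re, Complex.conj_im] at ih ⊢
    nlinarith [mul_nonneg hs (sq_nonneg (evY s (n + 1)).re),
      mul_nonneg hs (sq_nonneg (evY s (n + 1)).im)]

lemma re_neg_of_root (s : ℂ) (n : ℕ) (h : evY s (n + 1) = 0) : s.re < 0 := by
  by_contra hs
  have := evY_re_pos s (not_lt.mp hs) n
  rw [h] at this
  norm_num at this

lemma nextCoeff_pos (g : ℤ[X]) (hm : g.Monic) (hd : 0 < g.natDegree)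
    (hr : ∀ s : ℂ, aeval s g = 0 → s.re < 0) : 1 ≤ g.nextCoeff := by
  have hinj : Function.Injective (algebraMap ℤ ℂ) := (algebraMap ℤ ℂ).injective_int
  have hm' : (g.map (algebraMap ℤ ℂ)).Monic := hm.map _
  have hsp : (g.map (algebraMap ℤ ℂ)).Splits := IsAlgClosed.splits _
  have h1 := hsp.nextCoeff_eq_neg_sum_roots_of_monic hm'
  rw [nextCoeff_map hinj] at h1
  have hcard := hsp.natDegree_eq_card_roots
  rw [natDegree_map_eq_of_injective hinj] at hcard
  have hneg : ∀ (m : Multiset ℂ), (∀ x ∈ m, x.re < 0) → m ≠ 0 → m.sum.re < 0 := by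
    intro m
    induction m using Multiset.induction with
    | empty => intro _ h; exact absurd rfl h
    | cons a m ih =>
      intro hx _
      rw [Multiset.sum_cons, Complex.add_re]
      have ha := hx a (Multiset.mem_cons_self a m)
      by_cases hm0 : m = 0
      · simpa [hm0] using ha
      · have := ih (fun x hxm => hx x (Multiset.mem_cons_of_mem hxm)) hm0
        linarith
  have h2 : (g.map (algebraMap ℤ ℂ)).roots.sum.re < 0 := by
    apply hneg
    · intro x hx
      apply hr
      have := isRoot_of_mem_roots hx
      rwa [IsRoot.def, eval_map_algebraMap] at this
    · intro h0
      rw [h0] at hcard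
      simp at hcard
      omega
  have h3 := congrArg Complex.re h1
  rw [Complex.neg_re, eq_intCast, Complex.intCast_re] at h3
  have : (0:ℝ) < (g.nextCoeff : ℝ) := by rw [h3]; linarith
  have : 0 < g.nextCoeff := by exact_mod_cast this
  omega

lemma minpoly_eq_fibY (s : ℂ) (n : ℕ) (h : evY s (n + 2) = 0) :
    minpoly ℤ s = fibY (n + 2) := by
  obtain ⟨-, -, hm, hd, hc⟩ := fibY_props n
  have hint : IsIntegral ℤ s := ⟨fibY (n + 2), hm, by simpa [evY, aeval_def] using h⟩
  have hmm := minpoly.monic hint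
  obtain ⟨r, hr⟩ := minpoly.isIntegrallyClosed_dvd hint (p := fibY (n + 2)) h
  have hrm : r.Monic := hmm.of_mul_monic_left (hr ▸ hm)
  have hroots : ∀ t : ℂ, aeval t (fibY (n + 2)) = 0 → t.re < 0 :=
    fun t ht => re_neg_of_root t (n + 1) ht
  have h1 : 1 ≤ (minpoly ℤ s).nextCoeff := by
    apply nextCoeff_pos _ hmm (minpoly.natDegree_pos hint)
    intro t ht
    apply hroots
    rw [hr, map_mul, ht, zero_mul]
  have hnc : (fibY (n + 2)).nextCoeff = 1 := by
    rw [nextCoeff_of_natDegree_pos (by omega), hd]; simpa using hc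
  have hadd := hmm.nextCoeff_mul hrm
  rw [← hr, hnc] at hadd
  have h0 : r.natDegree = 0 := by
    by_contra hne
    have h2 : 1 ≤ r.nextCoeff := by
      apply nextCoeff_pos _ hrm (Nat.pos_of_ne_zero hne)
      intro t ht
      apply hroots
      rw [hr, map_mul, ht, mul_zero]
    omega
  have : r = 1 := hrm.natDegree_eq_zero.mp h0
  rw [hr, this, mul_one]

/-- the special point -/
noncomputable def alf : ℂ := (-1 + Complex.I) / 2
noncomputable def bet : ℂ := (-1 - Complex.I) / 2

lemma alf_sq : alf ^ 2 = -Complex.I / 2 := by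
  unfold alf
  linear_combination (1/4) * Complex.I_sq

lemma conj_alf : (starRingEnd ℂ) alf = bet := by
  simp only [alf, bet, map_div₀, map_add, map_neg, map_one, map_ofNat, Complex.conj_I]
  ring

lemma conj_evY (s : ℂ) (n : ℕ) : (starRingEnd ℂ) (evY s n) = evY ((starRingEnd ℂ) s) n := by
  induction n using Nat.strong_induction_on with
  | _ n ih =>
    match n with
    | 0 => simp [evY_zero]
    | 1 => simp [evY_one]
    | n + 2 =>
      rw [evY_add_two, evY_add_two, map_add, map_mul, ih (n + 1) (by omega), ih n (by omega)]

noncomputable def RR (p : ℕ) : ℂ := 2 ^ p * evY alf (2 * p + 1)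

lemma RR_rec (p : ℕ) : RR (p + 2) = (4 - Complex.I) * RR (p + 1) - 4 * RR p := by
  have e1 : evY alf (2 * p + 5) = alf * evY alf (2 * p + 4) + evY alf (2 * p + 3) :=
    evY_add_two _ _
  have e2 : evY alf (2 * p + 4) = alf * evY alf (2 * p + 3) + evY alf (2 * p + 2) :=
    evY_add_two _ _
  have e3 : evY alf (2 * p + 3) = alf * evY alf (2 * p + 2) + evY alf (2 * p + 1) :=
    evY_add_two _ _
  have e : evY alf (2 * p + 5) = (2 - Complex.I / 2) * evY alf (2 * p + 3)
      - evY alf (2 * p + 1) := by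
    linear_combination e1 + alf * e2 - e3 + evY alf (2 * p + 3) * alf_sq
  unfold RR
  have i1 : 2 * (p + 2) + 1 = 2 * p + 5 := by ring
  have i2 : 2 * (p + 1) + 1 = 2 * p + 3 := by ring
  rw [i1, i2, e]
  ring

lemma RR_zero : RR 0 = 1 := by simp [RR, evY_one]
lemma RR_one : RR 1 = 1 := by
  have e2 : evY alf 2 = alf * evY alf 1 + evY alf 0 := evY_add_two _ _
  have e3 : evY alf 3 = alf * evY alf 2 + evY alf 1 := evY_add_two _ _
  rw [evY_zero, evY_one] at e2
  rw [e2, evY_one] at e3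
  simp only [RR]
  rw [show 2 * 1 + 1 = 3 from rfl, e3]
  have := alf_sq
  have h : alf = (-1 + Complex.I) / 2 := rfl
  linear_combination 2 * this + 2 * h
lemma RR_two : RR 2 = -Complex.I := by
  rw [RR_rec 0, RR_one, RR_zero]; ring
lemma RR_three : RR 3 = -5 - 4 * Complex.I := by
  rw [RR_rec 1, RR_one, RR_two]
  linear_combination Complex.I_sq

lemma RR_growth (p : ℕ) : 1 ≤ ‖RR (p + 2)‖ ∧ 2 * ‖RR (p + 2)‖ ≤ ‖RR (p + 3)‖ := by
  induction p with
  | zero =>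
    simp only [zero_add]
    rw [RR_two, RR_three]
    have h : (5:ℝ) ≤ ‖(-5 - 4 * Complex.I : ℂ)‖ := by
      have := Complex.abs_re_le_norm (-5 - 4 * Complex.I)
      simpa using this
    simp only [norm_neg, Complex.norm_I]
    constructor <;> linarith
  | succ p ih =>
    obtain ⟨h1, h2⟩ := ih
    have h3 : p + 1 + 2 = p + 3 := by ring
    have h4 : RR (p + 1 + 3) = (4 - Complex.I) * RR (p + 3) - 4 * RR (p + 2) := RR_rec (p + 2)
    rw [h3, h4]
    have hn : (4:ℝ) ≤ ‖(4 - Complex.I : ℂ)‖ := by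
      have := Complex.abs_re_le_norm (4 - Complex.I)
      simpa using this
    refine ⟨by linarith, ?_⟩
    have := norm_sub_norm_le ((4 - Complex.I) * RR (p + 3)) (4 * RR (p + 2))
    rw [norm_mul, norm_mul] at this
    have h5 : ‖(4:ℂ)‖ = 4 := by simp
    rw [h5] at this
    nlinarith [norm_nonneg (RR (p + 3))]

lemma norm_unit {K : Type} [Field K] [Algebra ℚ K] (pb : PowerBasis ℚ K) (F : ℤ[X])
    (hF : minpoly ℚ pb.gen = F.map (algebraMap ℤ ℚ)) (u : K)
    (hudef : u = 2 * pb.gen ^ 2 + 2 * pb.gen + 1) (hu0 : u ≠ 0)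
    (huint : IsIntegral ℤ u) (huinv : IsIntegral ℤ u⁻¹) :
    ‖(2 : ℂ) ^ pb.dim * (aeval alf F * aeval bet F)‖ = 1 := by
  obtain ⟨a, ha⟩ := IsIntegrallyClosed.isIntegral_iff.mp (Algebra.isIntegral_norm ℚ huint)
  obtain ⟨b, hb⟩ := IsIntegrallyClosed.isIntegral_iff.mp (Algebra.isIntegral_norm ℚ huinv)
  have hab : a * b = 1 := by
    have h1 : Algebra.norm ℚ u * Algebra.norm ℚ u⁻¹ = 1 := by
      rw [← map_mul, mul_inv_cancel₀ hu0, map_one]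
    rw [← ha, ← hb, ← map_mul] at h1
    simp at h1
    exact_mod_cast h1
  have habs : (|a| : ℤ) = 1 := Int.isUnit_iff_abs_eq.mp (IsUnit.of_mul_eq_one _ hab)
  let M := Algebra.leftMulMatrix pb.basis pb.gen
  have hMc : M.charpoly = F.map (algebraMap ℤ ℚ) := by
    rw [← hF]; exact charpoly_leftMulMatrix pb
  let N := M.map (algebraMap ℚ ℂ)
  have hNc : N.charpoly = F.map (algebraMap ℤ ℂ) := by
    have : N.charpoly = M.charpoly.map (algebraMap ℚ ℂ) := Matrix.charpoly_map M _
    rw [this, hMc, Polynomial.map_map]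
    congr 1
  have hdet : Algebra.norm ℚ u = (2 * M ^ 2 + 2 * M + 1).det := by
    rw [Algebra.norm_eq_matrix_det pb.basis]
    congr 1
    simp only [hudef, M, map_add, map_mul, map_pow, map_one, map_ofNat]
  have hdetC : ((a : ℤ) : ℂ) = (2 * N ^ 2 + 2 * N + 1).det := by
    have h1 : ((a : ℤ) : ℂ) = algebraMap ℚ ℂ (Algebra.norm ℚ u) := by
      rw [← ha]; simp
    rw [h1, hdet, RingHom.map_det]
    congr 1
    simp only [map_add, map_mul, map_pow, map_one, map_ofNat]
    rfl
  have hfac : (2 * N ^ 2 + 2 * N + 1) =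
      (2 : ℂ) • ((Matrix.scalar _ alf - N) * (Matrix.scalar _ bet - N)) := by
    have hs1 : Matrix.scalar (Fin pb.dim) alf = alf • 1 := by
      simp [Matrix.smul_one_eq_diagonal]
    have hs2 : Matrix.scalar (Fin pb.dim) bet = bet • 1 := by
      simp [Matrix.smul_one_eq_diagonal]
    have hsum : alf + bet = -1 := by simp only [alf, bet]; ring
    have hprod : alf * bet = 1 / 2 := by
      simp only [alf, bet]; linear_combination (-1/4) * Complex.I_sq
    have hexp : (Matrix.scalar _ alf - N) * (Matrix.scalar _ bet - N) =
        (alf * bet) • (1 : Matrix (Fin pb.dim) (Fin pb.dim) ℂ) - (alf + bet) • N + N ^ 2 := by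
      rw [hs1, hs2, mul_comm alf bet]
      simp only [sub_mul, mul_sub, smul_mul_assoc, mul_smul_comm, one_mul, mul_one, mul_smul,
        add_smul, sq, smul_sub]
      abel
    rw [hexp, hsum, hprod]
    have h2 : (2 : Matrix (Fin pb.dim) (Fin pb.dim) ℂ) = (2:ℂ) • 1 := by
      rw [two_smul]; norm_num
    rw [h2]
    simp only [smul_add, smul_sub, smul_smul, smul_mul_assoc, one_mul]
    norm_num
    abel
  have hfin : ((a : ℤ) : ℂ) = 2 ^ pb.dim * (aeval alf F * aeval bet F) := by
    rw [hdetC, hfac, Matrix.det_smul, Matrix.det_mul, ← Matrix.eval_charpoly,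
      ← Matrix.eval_charpoly, hNc, Fintype.card_fin, eval_map_algebraMap,
      eval_map_algebraMap]
  rw [← hfin, Complex.norm_intCast]
  exact_mod_cast habs

lemma norm_RR_eq_one (p : ℕ) (hp : 2 ≤ p) (s : ℂ) (hs : evY s (2 * p + 1) = 0)
    (hu : (2 * s ^ 2 + 2 * s + 1) * (starRingEnd ℂ) (2 * s ^ 2 + 2 * s + 1) = 1) :
    ‖RR p‖ = 1 := by
  obtain ⟨n, rfl⟩ : ∃ n, p = n + 1 := ⟨p - 1, by omega⟩
  have hidx : 2 * (n + 1) + 1 = (2 * n + 1) + 2 := by ring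
  rw [hidx] at hs
  have hmin := minpoly_eq_fibY s _ hs
  obtain ⟨-, -, hm, hd, -⟩ := fibY_props (2 * n + 1)
  have hint : IsIntegral ℤ s := ⟨_, hm, by simpa [evY, aeval_def] using hs⟩
  have hintQ : IsIntegral ℚ s := hint.tower_top
  have hminQ : minpoly ℚ s = (fibY (2 * n + 1 + 2)).map (algebraMap ℤ ℚ) := by
    rw [minpoly.isIntegrallyClosed_eq_field_fractions' ℚ hint, hmin]
  have hgen : (((IntermediateField.adjoin.powerBasis hintQ).gen :
      IntermediateField.adjoin ℚ {s}) : ℂ) = s := by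
    simp
  obtain ⟨g, hg⟩ : ∃ g, g = (IntermediateField.adjoin.powerBasis hintQ).gen := ⟨_, rfl⟩
  rw [← hg] at hgen
  obtain ⟨u, hudef⟩ : ∃ u : IntermediateField.adjoin ℚ {s}, u = 2 * g ^ 2 + 2 * g + 1 := ⟨_, rfl⟩
  have huc : (u : ℂ) = 2 * s ^ 2 + 2 * s + 1 := by
    have h1 : (u : ℂ) = 2 * (g : ℂ) ^ 2 + 2 * (g : ℂ) + 1 := by rw [hudef]; rfl
    rw [h1, hgen]
  have hconj : IsIntegral ℤ ((starRingEnd ℂ) s) := by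
    have := hint.map ((starRingEnd ℂ).toIntAlgHom)
    simpa using this
  have two_int : ∀ x : ℂ, IsIntegral ℤ x → IsIntegral ℤ (2 * x ^ 2 + 2 * x + 1) := by
    intro x hx
    have h2 : IsIntegral ℤ (2:ℂ) := by
      have := isIntegral_algebraMap (R := ℤ) (A := ℂ) (x := 2)
      simpa using this
    exact ((h2.mul (hx.pow 2)).add (h2.mul hx)).add isIntegral_one
  have hval : Function.Injective (algebraMap (IntermediateField.adjoin ℚ {s}) ℂ) :=
    (algebraMap (IntermediateField.adjoin ℚ {s}) ℂ).injective
  have huint : IsIntegral ℤ u := by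
    rw [← isIntegral_algebraMap_iff hval]
    change IsIntegral ℤ (u : ℂ)
    rw [huc]; exact two_int s hint
  have huinv : IsIntegral ℤ u⁻¹ := by
    rw [← isIntegral_algebraMap_iff hval]
    change IsIntegral ℤ ((u⁻¹ : IntermediateField.adjoin ℚ {s}) : ℂ)
    have : ((u⁻¹ : IntermediateField.adjoin ℚ {s}) : ℂ) =
        (starRingEnd ℂ) (2 * s ^ 2 + 2 * s + 1) := by
      rw [IntermediateField.coe_inv, huc]
      exact inv_eq_of_mul_eq_one_right hu
    rw [this]
    simpa only [map_add, map_mul, map_pow, map_one, map_ofNat] using two_int _ hconj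
  have hu0 : u ≠ 0 := by
    intro h0
    rw [← huc, h0] at hu
    simp at hu
  have hnorm := norm_unit (IntermediateField.adjoin.powerBasis hintQ) (fibY (2 * n + 1 + 2))
    (by rw [IntermediateField.minpoly_eq, ← hg, hgen, hminQ]) u (by rw [← hg]; exact hudef)
    hu0 huint huinv
  have hdim : (IntermediateField.adjoin.powerBasis hintQ).dim = 2 * n + 2 := by
    rw [IntermediateField.adjoin.powerBasis_dim, hminQ, hm.natDegree_map, hd]
  rw [hdim] at hnorm
  change ‖(2 : ℂ) ^ (2 * n + 2) * (evY alf (2 * n + 1 + 2) * evY bet (2 * n + 1 + 2))‖ = 1 at hnorm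
  rw [← conj_alf, ← conj_evY, norm_mul, norm_mul, RCLike.norm_conj, norm_pow] at hnorm
  have hR : ‖RR (n + 1)‖ ^ 2 = 1 := by
    unfold RR
    rw [hidx, norm_mul, norm_pow, ← hnorm]; ring
  exact (pow_eq_one_iff_of_nonneg (norm_nonneg _) (by norm_num)).mp hR

lemma case_two (s : ℂ) (hs : evY s 5 = 0)
    (hu : (2 * s ^ 2 + 2 * s + 1) * (starRingEnd ℂ) (2 * s ^ 2 + 2 * s + 1) = 1) : False := by
  have e2 : evY s 2 = s * evY s 1 + evY s 0 := evY_add_two _ _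
  have e3 : evY s 3 = s * evY s 2 + evY s 1 := evY_add_two _ _
  have e4 : evY s 4 = s * evY s 3 + evY s 2 := evY_add_two _ _
  have e5 : evY s 5 = s * evY s 4 + evY s 3 := evY_add_two _ _
  have hP : s ^ 4 + s ^ 3 + 3 * s ^ 2 + 2 * s + 1 = 0 := by
    rw [← hs, e5, e4, e3, e2, evY_one, evY_zero]; ring
  obtain ⟨a, b⟩ := s
  have hre := congrArg Complex.re hP
  have him := congrArg Complex.im hP
  have hur := congrArg Complex.re hu
  simp [pow_succ] at hre him hur
  ring_nf at hre him hur
  have hb : b ≠ 0 := by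
    rintro rfl
    nlinarith [sq_nonneg (a ^ 2 + a / 2), sq_nonneg (a + 1 / 2), sq_nonneg a]
  obtain ⟨e, he⟩ : ∃ e, e = 2 * a := ⟨_, rfl⟩
  obtain ⟨f, hf⟩ : ∃ f, f = a ^ 2 + b ^ 2 := ⟨_, rfl⟩
  have hA : e ^ 3 - 2 * e * f + e ^ 2 - f + 3 * e + 2 = 0 := by
    apply mul_left_cancel₀ hb
    rw [mul_zero, he, hf]
    linear_combination him
  have hB : -f * e ^ 2 + f ^ 2 - e * f - 3 * f + 1 = 0 := by
    rw [he, hf] at *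
    linear_combination hre - a * hA
  have hC : 2 * f ^ 2 + 2 * f * e + e ^ 2 + e = 0 := by
    rw [he, hf]
    linear_combination hur / 2
  have hf0 : 0 ≤ f := by rw [hf]; positivity
  have h1 : e * (1 - f ^ 2) = f ^ 2 - 2 * f := by
    linear_combination f * hA + e * hB
  have h2 : 2 * f ^ 3 + 2 * f ^ 2 * e + f ^ 2 - 3 * f + 1 = 0 := by
    linear_combination f * hC + hB
  have h3 : -2 * f ^ 5 + f ^ 4 + f ^ 3 - 3 * f + 1 = 0 := by
    linear_combination (1 - f ^ 2) * h2 - 2 * f ^ 2 * h1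
  have hlt : f < 3 / 8 := by
    by_contra hcon
    push Not at hcon
    obtain ⟨t, ht, rfl⟩ : ∃ t : ℝ, 0 ≤ t ∧ f = t + 3 / 8 := ⟨f - 3 / 8, by linarith, by ring⟩
    nlinarith [mul_nonneg ht (sq_nonneg (t^2 - 1/2)), mul_nonneg ht (sq_nonneg (t - 1)), mul_nonneg ht (sq_nonneg (t^2 - t)), mul_nonneg ht (sq_nonneg t), pow_nonneg ht 3, pow_nonneg ht 4, pow_nonneg ht 5]
  have hf00 : 0 < f := by
    rcases hf0.lt_or_eq with h | h
    · exact h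
    · rw [← h] at h3; norm_num at h3
  have hd : 0 < 1 - f ^ 2 := by nlinarith
  have he0 : e < 0 := by
    by_contra hcon
    push Not at hcon
    nlinarith [mul_nonneg hcon hd.le]
  have he1 : 0 < 1 + e := by
    have : 0 < (1 + e) * (1 - f ^ 2) := by nlinarith
    exact pos_of_mul_pos_left this hd.le
  have : f * (e * (1 + e)) = f ^ 2 - 3 * f + 1 := by linear_combination -hB
  nlinarith [mul_pos hf00 (mul_pos (neg_pos.mpr he0) he1)]

lemma key (p : ℕ) (hp : 2 ≤ p) (s : ℂ) (hs : evY s (2 * p + 1) = 0)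
    (hu : (2 * s ^ 2 + 2 * s + 1) * (starRingEnd ℂ) (2 * s ^ 2 + 2 * s + 1) = 1) : False := by
  rcases hp.eq_or_lt with rfl | hlt
  · exact case_two s hs hu
  · have h1 := norm_RR_eq_one p hp s hs hu
    obtain ⟨n, rfl⟩ : ∃ n, p = n + 3 := ⟨p - 3, by omega⟩
    have := RR_growth n
    linarith

theorem re_z2_eq_one_imp_im_eq_zero (p : ℕ) (hp : 2 ≤ p) (z : ℕ → ℂ)
    (hz : GluingSystem p z) (h : (z 2).re = 1) : (z 2).im = 0 := by
  obtain ⟨hn, h1, h2, h3⟩ := hz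
  exfalso
  have hz0 : ∀ i, 1 ≤ i → i ≤ 2 * p - 1 → z i ≠ 0 := by
    intro i hi1 hi2 h0
    exact hn i hi1 hi2 ⟨0, le_rfl, by simp [h0]⟩
  have hz1 : ∀ i, 1 ≤ i → i ≤ 2 * p - 1 → z i ≠ 1 := by
    intro i hi1 hi2 h0
    exact hn i hi1 hi2 ⟨1, zero_le_one, by simp [h0]⟩
  obtain ⟨w, hw⟩ : ∃ w : ℕ → ℂ, w = fun i => (z i)⁻¹ := ⟨_, rfl⟩
  have hzw : ∀ i, z i = (w i)⁻¹ := by intro i; simp [hw]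
  have w0 : ∀ i, 1 ≤ i → i ≤ 2 * p - 1 → w i ≠ 0 := by
    intro i hi1 hi2; rw [hw]; exact inv_ne_zero (hz0 i hi1 hi2)
  have w1 : ∀ i, 1 ≤ i → i ≤ 2 * p - 1 → w i - 1 ≠ 0 := by
    intro i hi1 hi2 h0
    apply hz1 i hi1 hi2
    rw [hzw, sub_eq_zero.mp h0, inv_one]
  obtain ⟨s, hsdef⟩ : ∃ s, s = w 1 - 1 := ⟨_, rfl⟩
  have hs0 : s ≠ 0 := hsdef ▸ w1 1 le_rfl (by omega)
  -- first equation
  have E1 : w 2 - 1 = w 1 * (w 1 - 1) := by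
    have a1 := w0 1 le_rfl (by omega)
    have a2 := w0 2 (by omega) (by omega)
    rw [hzw 1, hzw 2] at h1
    field_simp at h1
    linear_combination -h1
  have E2 : ∀ i, 2 ≤ i → i ≤ 2 * p - 2 → (w (i + 1) - 1) * w (i - 1) = w i * (w (i - 1) - 1) := by
    intro i hi1 hi2
    have a1 := w0 (i - 1) (by omega) (by omega)
    have a2 := w0 i (by omega) (by omega)
    have a3 := w0 (i + 1) (by omega) (by omega)
    have b2 := w1 i (by omega) (by omega)
    have e := h2 i hi1 hi2
    rw [hzw i, hzw (i - 1), hzw (i + 1)] at e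
    field_simp at e
    apply mul_left_cancel₀ b2
    linear_combination e
  have E3 : w (2 * p - 1) = (1 + w (2 * p - 1)) * w (2 * p - 2) := by
    have a1 := w0 (2 * p - 2) (by omega) (by omega)
    have a2 := w0 (2 * p - 1) (by omega) (by omega)
    have b2 := w1 (2 * p - 1) (by omega) (by omega)
    rw [hzw (2 * p - 1), hzw (2 * p - 2)] at h3
    field_simp at h3
    apply mul_left_cancel₀ b2
    linear_combination h3
  have cons : ∀ i, 1 ≤ i → i ≤ 2 * p - 2 → (w (i + 1) - 1) * (w i - 1) = s ^ 2 * w i := by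
    intro i hi
    induction i, hi using Nat.le_induction with
    | base => intro _; rw [hsdef]; linear_combination (w 1 - 1) * E1
    | succ i hi ih =>
      intro hi2
      have e := E2 (i + 1) (by omega) hi2
      have ih' := ih (by omega)
      have a1 := w0 i (by omega) (by omega)
      simp only [Nat.add_sub_cancel] at e
      apply mul_right_cancel₀ a1
      linear_combination (w (i + 1) - 1) * e + w (i + 1) * ih'
  have form : ∀ i, i ≤ 2 * p - 2 → evY s i ≠ 0 ∧ (w (i + 1) - 1) * evY s i = s * evY s (i + 1) := by
    intro i
    induction i with
    | zero => intro _; rw [evY_zero, evY_one, hsdef]; simp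
    | succ i ih =>
      intro hi
      obtain ⟨n0, e⟩ := ih (by omega)
      have b1 := w1 (i + 1) (by omega) (by omega)
      have n1 : evY s (i + 1) ≠ 0 := by
        intro h0
        rw [h0, mul_zero] at e
        exact (mul_ne_zero b1 n0) e
      refine ⟨n1, ?_⟩
      have c := cons (i + 1) (by omega) hi
      rw [evY_add_two]
      apply mul_left_cancel₀ (mul_ne_zero n0 b1)
      linear_combination evY s i * evY s (i + 1) * c - s * evY s i * e
  have root : evY s (2 * p + 1) = 0 := by
    obtain ⟨n, rfl⟩ : ∃ n, p = n + 2 := ⟨p - 2, by omega⟩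
    have i1 : 2 * (n + 2) - 1 = 2 * n + 3 := by omega
    have i2 : 2 * (n + 2) - 2 = 2 * n + 2 := by omega
    have i3 : 2 * (n + 2) + 1 = 2 * n + 5 := by omega
    rw [i2] at form cons
    rw [i1] at w0 w1
    rw [i1, i2] at E3
    rw [i3]
    obtain ⟨n0, e⟩ := form (2 * n + 2) le_rfl
    have c := cons (2 * n + 2) (by omega) le_rfl
    have r5 : evY s (2 * n + 5) = s * evY s (2 * n + 4) + evY s (2 * n + 3) := evY_add_two _ _
    have r4 : evY s (2 * n + 4) = s * evY s (2 * n + 3) + evY s (2 * n + 2) := evY_add_two _ _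
    simp only [show 2 * n + 2 + 1 = 2 * n + 3 from rfl] at c e
    have a1 := w0 (2 * n + 2) (by omega) (by omega)
    have a2 := w0 (2 * n + 3) (by omega) (by omega)
    have b2 := w1 (2 * n + 3) (by omega) (by omega)
    -- s² wₙ = -(wₙ - 1)
    have d : s ^ 2 * w (2 * n + 3) = -(w (2 * n + 3) - 1) := by
      apply mul_left_cancel₀ a1
      linear_combination (-w (2 * n + 3)) * c - (w (2 * n + 3) - 1) * E3
    rw [r5, r4]
    apply mul_left_cancel₀ hs0
    linear_combination (-(s ^ 2 + 1)) * e + evY s (2 * n + 2) * d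
  apply key p hp s root
  have hu : 2 * s ^ 2 + 2 * s + 1 = 2 * w 2 - 1 := by
    rw [hsdef]; linear_combination -2 * E1
  rw [hu]
  have hz2 := hz0 2 (by omega) (by omega)
  have hcz2 : (starRingEnd ℂ) (z 2) ≠ 0 := by simpa using hz2
  have hsum : z 2 + (starRingEnd ℂ) (z 2) = 2 := by
    rw [Complex.add_conj, h]; norm_num
  have hw2 : w 2 = (z 2)⁻¹ := by rw [hw]
  rw [hw2]
  simp only [map_sub, map_mul, map_inv₀, map_one, map_ofNat]
  field_simp
  linear_combination (-2) * hsum
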